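/- If T is a continuous piecewise C^1 expanding map of [0,1], then Θ^∞(β) ≤ e^{h_top(T)} · lim_k (sup_{x∈[0,1]} |DT^k(x)|^{-β})^{1/k}, where h_top(T) is the topological entropy of T. More generally, without continuity, Θ^∞(β) ≤ (#P^1) · lim_k (sup_x |DT^k(x)|^{-β})^{1/k}. -/

import Mathlib

open Set Filter Topology

/-- The domain of the branch of `T^[k]` determined by the word `w` of branch indices. -/
def branchDom (T : ℝ → ℝ) {ι : Type*} (I : ι → Set ℝ) {k : ℕ} (w : Fin k → ι) : Set ℝ :=
  {x | ∀ j : Fin k, T^[(j : ℕ)] x ∈ I (w j)}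

/-- `θ^k_w = sup_{x ∈ I^k_w} 1 / |DT^k(x)|`. -/
noncomputable def theta (T : ℝ → ℝ) {ι : Type*} (I : ι → Set ℝ) {k : ℕ} (w : Fin k → ι) : ℝ :=
  ⨆ x ∈ branchDom T I w, 1 / |deriv (T^[k]) x|

/-- `Θ^k(β) = ∑_w (θ^k_w)^β`, summing over the monotonicity branches of `T^k`. -/
noncomputable def Theta (T : ℝ → ℝ) {ι : Type*} [Fintype ι] (I : ι → Set ℝ) (β : ℝ) (k : ℕ) :
    ℝ :=
  ∑ w : Fin k → ι, theta T I w ^ β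

/-- `Θ^∞(β) = lim_k (Θ^k(β))^{1/k} = inf_{k ≥ 1} (Θ^k(β))^{1/k}`. -/
noncomputable def ThetaInf (T : ℝ → ℝ) {ι : Type*} [Fintype ι] (I : ι → Set ℝ) (β : ℝ) : ℝ :=
  ⨅ k : {n : ℕ // 0 < n}, Theta T I β (k : ℕ) ^ (1 / ((k : ℕ) : ℝ))

section BranchDom

variable {T : ℝ → ℝ} {ι : Type*} {I : ι → Set ℝ}

theorem branchDom_succ {k : ℕ} (w : Fin (k + 1) → ι) :
    branchDom T I w = I (w 0) ∩ T ⁻¹' branchDom T I (Fin.tail w) := by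
  ext x
  simp [branchDom, Fin.forall_fin_succ, Fin.tail]

theorem eq_of_mem_branchDom (hdisj : Pairwise (Function.onFun Disjoint I)) {k : ℕ}
    {v w : Fin k → ι} {x : ℝ} (hv : x ∈ branchDom T I v) (hw : x ∈ branchDom T I w) : v = w := by
  funext j
  by_contra h
  exact (Set.disjoint_left.1 (hdisj h)) (hv j) (hw j)

/-- A function with nonvanishing derivative on an interval is injective there. -/
theorem injOn_of_deriv_ne_zero {f : ℝ → ℝ} {s : Set ℝ} (hs : s.OrdConnected)
    (hf : ContinuousOn f s) (h : ∀ x ∈ s, deriv f x ≠ 0) : InjOn f s := by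
  have key : ∀ x ∈ s, ∀ y ∈ s, x < y → f x ≠ f y := by
    intro x hx y hy hxy he
    obtain ⟨c, hc, hc0⟩ := exists_deriv_eq_zero hxy (hf.mono (hs.out hx hy)) he
    exact h c (hs.out hx hy (Ioo_subset_Icc_self hc)) hc0
  intro x hx y hy he
  rcases lt_trichotomy x y with hlt | heq | hlt
  · exact absurd he (key x hx y hy hlt)
  · exact heq
  · exact absurd he.symm (key y hy x hx hlt)

theorem ordConnected_inter_preimage {f : ℝ → ℝ} {s t : Set ℝ} (hs : s.OrdConnected)
    (ht : t.OrdConnected) (hf : ContinuousOn f s) (hinj : InjOn f s) :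
    (s ∩ f ⁻¹' t).OrdConnected := by
  refine ⟨fun x hx y hy z hz => ?_⟩
  have hsub : Icc x y ⊆ s := hs.out hx.1 hy.1
  refine ⟨hsub hz, ?_⟩
  have hxy : x ≤ y := hz.1.trans hz.2
  have hxm := left_mem_Icc.2 hxy
  have hym := right_mem_Icc.2 hxy
  rcases (hf.mono hsub).strictMonoOn_of_injOn_Icc' hxy (hinj.mono hsub) with hm | hm
  · exact ht.out hx.2 hy.2 ⟨hm.monotoneOn hxm hz hz.1, hm.monotoneOn hz hym hz.2⟩
  · exact ht.out hy.2 hx.2 ⟨hm.antitoneOn hz hym hz.2, hm.antitoneOn hxm hz hz.1⟩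

theorem ordConnected_branchDom (hord : ∀ i, (I i).OrdConnected)
    (hcont : ∀ i, ContinuousOn T (I i)) (hinj : ∀ i, InjOn T (I i)) :
    ∀ {k : ℕ} (w : Fin k → ι), (branchDom T I w).OrdConnected
  | 0, w => by
    have : branchDom T I w = univ := by ext x; simp [branchDom]
    rw [this]; exact ordConnected_univ
  | k + 1, w => by
    rw [branchDom_succ]
    exact ordConnected_inter_preimage (hord _) (ordConnected_branchDom hord hcont hinj _)
      (hcont _) (hinj _)

theorem isOpen_branchDom (hopen : ∀ i, IsOpen (I i)) (hcont : ∀ i, ContinuousOn T (I i)) :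
    ∀ {k : ℕ} (w : Fin k → ι), IsOpen (branchDom T I w)
  | 0, w => by
    have : branchDom T I w = univ := by ext x; simp [branchDom]
    rw [this]; exact isOpen_univ
  | k + 1, w => by
    rw [branchDom_succ]
    exact (hcont _).isOpen_inter_preimage (hopen _) (isOpen_branchDom hopen hcont _)

/-- Along a branch of `T^[k]`, the derivative has absolute value at least `1`. -/
theorem one_le_abs_deriv_iterate (hdiff : ∀ i, ∀ x ∈ I i, DifferentiableAt ℝ T x)
    (hexp : ∀ i, ∀ x ∈ I i, 1 < |deriv T x|) {x : ℝ} :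
    ∀ {k : ℕ} (w : Fin k → ι), x ∈ branchDom T I w →
      DifferentiableAt ℝ (T^[k]) x ∧ 1 ≤ |deriv (T^[k]) x|
  | 0, w, _ => by
    simp [Function.iterate_zero]
  | k + 1, w, hx => by
    have hx' : x ∈ branchDom T I (Fin.init w) := fun j => hx j.castSucc
    obtain ⟨hd, h1⟩ := one_le_abs_deriv_iterate hdiff hexp (Fin.init w) hx'
    have hl : T^[k] x ∈ I (w (Fin.last k)) := hx (Fin.last k)
    have hT := hdiff _ _ hl
    rw [Function.iterate_succ']
    refine ⟨hT.comp x hd, ?_⟩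
    rw [deriv_comp x hT hd, abs_mul]
    exact one_le_mul_of_one_le_of_one_le (hexp _ _ hl).le h1

theorem finite_closure_diff {s : Set ℝ} (hs : s.OrdConnected) (hbb : BddBelow s)
    (hba : BddAbove s) : (closure s \ s).Finite := by
  rcases s.eq_empty_or_nonempty with rfl | hne
  · simp
  refine Set.Finite.subset (Set.toFinite {sInf s, sSup s}) fun x hx => ?_
  have hconn : IsConnected s := ⟨hne, hs.isPreconnected⟩
  have h1 := closure_minimal (subset_Icc_csInf_csSup hbb hba) isClosed_Icc hx.1
  by_contra h
  simp only [mem_insert_iff, mem_singleton_iff, not_or] at h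
  exact hx.2 (hconn.Ioo_csInf_csSup_subset hbb hba
    ⟨lt_of_le_of_ne h1.1 (Ne.symm h.1), lt_of_le_of_ne h1.2 h.2⟩)

theorem finite_Icc_diff_iUnion [Finite ι] (hord : ∀ i, (I i).OrdConnected)
    (hsub : ∀ i, I i ⊆ Ioo (0 : ℝ) 1) (hcov : Ioo (0 : ℝ) 1 ⊆ closure (⋃ i, I i)) :
    (Icc (0 : ℝ) 1 \ ⋃ i, I i).Finite := by
  have hfin : (⋃ i, closure (I i) \ I i).Finite := Set.finite_iUnion fun i =>
    finite_closure_diff (hord i) (bddBelow_Ioo.mono (hsub i)) (bddAbove_Ioo.mono (hsub i))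
  refine (hfin.union (Set.toFinite {(0 : ℝ), 1})).subset fun x hx => ?_
  by_cases h : x ∈ Ioo (0 : ℝ) 1
  · left
    have := hcov h
    rw [closure_iUnion_of_finite] at this
    obtain ⟨i, hi⟩ := mem_iUnion.1 this
    exact mem_iUnion.2 ⟨i, hi, fun hxi => hx.2 (mem_iUnion.2 ⟨i, hxi⟩)⟩
  · right
    by_contra hne
    simp only [mem_insert_iff, mem_singleton_iff, not_or] at hne
    exact h ⟨lt_of_le_of_ne hx.1.1 (Ne.symm hne.1), lt_of_le_of_ne hx.1.2 hne.2⟩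

theorem finite_Icc_diff_iUnion_branchDom [Finite ι]
    (hmaps : MapsTo T (Icc (0 : ℝ) 1) (Icc (0 : ℝ) 1))
    (hinj : ∀ i, InjOn T (I i)) (hfin : (Icc (0 : ℝ) 1 \ ⋃ i, I i).Finite) :
    ∀ k : ℕ, (Icc (0 : ℝ) 1 \ ⋃ w : Fin k → ι, branchDom T I w).Finite
  | 0 => by
    refine Set.finite_empty.subset fun x hx => hx.2 (mem_iUnion.2 ⟨Fin.elim0, fun j => j.elim0⟩)
  | k + 1 => by
    have ih := finite_Icc_diff_iUnion_branchDom hmaps hinj hfin k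
    have hpre : (⋃ i, I i ∩ T ⁻¹' (Icc (0 : ℝ) 1 \ ⋃ w : Fin k → ι, branchDom T I w)).Finite :=
      Set.finite_iUnion fun i => ih.of_injOn (f := T) (fun x hx => hx.2)
        ((hinj i).mono inter_subset_left)
    refine (hfin.union hpre).subset fun x hx => ?_
    by_cases h : x ∈ ⋃ i, I i
    · right
      obtain ⟨i, hi⟩ := mem_iUnion.1 h
      refine mem_iUnion.2 ⟨i, hi, hmaps hx.1, fun hw => hx.2 ?_⟩
      obtain ⟨w, hw⟩ := mem_iUnion.1 hw
      refine mem_iUnion.2 ⟨Fin.cons i w, ?_⟩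
      rw [branchDom_succ]
      exact ⟨by simpa using hi, by simpa using hw⟩
    · exact Or.inl ⟨hx.1, h⟩

theorem bddAbove_rpow_inv_abs_deriv {β : ℝ} (hβ : 0 ≤ β)
    (hdiff : ∀ i, ∀ x ∈ I i, DifferentiableAt ℝ T x)
    (hexp : ∀ i, ∀ x ∈ I i, 1 < |deriv T x|) {k : ℕ}
    (hfin : (Icc (0 : ℝ) 1 \ ⋃ w : Fin k → ι, branchDom T I w).Finite) :
    BddAbove ((fun x => (1 / |deriv (T^[k]) x|) ^ β) '' Icc (0 : ℝ) 1) := by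
  have h := (hfin.image fun x => (1 / |deriv (T^[k]) x|) ^ β).bddAbove
  refine (h.union (bddAbove_Iic (a := (1 : ℝ)))).mono ?_
  rintro _ ⟨x, hx, rfl⟩
  by_cases hw : x ∈ ⋃ w : Fin k → ι, branchDom T I w
  · right
    obtain ⟨w, hw⟩ := mem_iUnion.1 hw
    have h1 := (one_le_abs_deriv_iterate hdiff hexp w hw).2
    exact Real.rpow_le_one (by positivity) (div_le_one_of_le₀ h1 (by positivity)) hβ
  · exact Or.inl ⟨x, ⟨hx, hw⟩, rfl⟩

end BranchDom

theorem le_biSup_of_bddAbove_image {f : ℝ → ℝ} {s : Set ℝ} (h : BddAbove (f '' s)) {x : ℝ}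
    (hx : x ∈ s) : f x ≤ ⨆ y ∈ s, f y := by
  obtain ⟨M, hM⟩ := h
  refine le_ciSup_of_le (f := fun y => ⨆ _ : y ∈ s, f y) ⟨max M 0, ?_⟩ x ?_
  · rintro _ ⟨y, rfl⟩
    exact Real.iSup_le (fun hy => le_max_of_le_left (hM ⟨y, hy, rfl⟩)) (le_max_right _ _)
  · simp [hx]

section Theta

variable {T : ℝ → ℝ} {ι : Type*} {I : ι → Set ℝ}

theorem theta_nonneg {k : ℕ} (w : Fin k → ι) : 0 ≤ theta T I w :=
  Real.iSup_nonneg fun _ => Real.iSup_nonneg fun _ => by positivity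

theorem theta_of_empty {k : ℕ} {w : Fin k → ι} (h : branchDom T I w = ∅) : theta T I w = 0 := by
  simp [theta, h]

theorem biSup_rpow_nonneg (T : ℝ → ℝ) (β : ℝ) (k : ℕ) :
    0 ≤ ⨆ x ∈ Icc (0 : ℝ) 1, (1 / |deriv (T^[k]) x|) ^ β :=
  Real.iSup_nonneg fun _ => Real.iSup_nonneg fun _ => by positivity

theorem theta_rpow_le {β : ℝ} (hβ : 0 < β) {k : ℕ} {w : Fin k → ι}
    (hw : branchDom T I w ⊆ Icc 0 1)
    (hbdd : BddAbove ((fun x => (1 / |deriv (T^[k]) x|) ^ β) '' Icc (0 : ℝ) 1)) :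
    theta T I w ^ β ≤ ⨆ x ∈ Icc (0 : ℝ) 1, (1 / |deriv (T^[k]) x|) ^ β := by
  have hS := biSup_rpow_nonneg T β k
  set S := ⨆ x ∈ Icc (0 : ℝ) 1, (1 / |deriv (T^[k]) x|) ^ β with hSdef
  have h : theta T I w ≤ S ^ (1 / β) := by
    refine Real.iSup_le (fun x => Real.iSup_le (fun hx => ?_) (by positivity)) (by positivity)
    have h1 : (1 / |deriv (T^[k]) x|) ^ β ≤ S :=
      le_biSup_of_bddAbove_image hbdd (hw hx)
    rw [one_div β]
    exact (Real.le_rpow_inv_iff_of_pos (by positivity) hS hβ).2 h1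
  calc theta T I w ^ β ≤ (S ^ (1 / β)) ^ β := by gcongr; exact theta_nonneg w
    _ = S := by rw [one_div, Real.rpow_inv_rpow hS hβ.ne']

variable [Fintype ι]

open Classical in
/-- `Θ^k(β)` is at most the number of branches of `T^[k]` times the largest contribution. -/
theorem Theta_le_card_mul {β : ℝ} (hβ : 0 < β) {k : ℕ}
    (hw : ∀ w : Fin k → ι, branchDom T I w ⊆ Icc 0 1)
    (hbdd : BddAbove ((fun x => (1 / |deriv (T^[k]) x|) ^ β) '' Icc (0 : ℝ) 1)) :
    Theta T I β k ≤ (Finset.univ.filter fun w : Fin k → ι => (branchDom T I w).Nonempty).card *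
      ⨆ x ∈ Icc (0 : ℝ) 1, (1 / |deriv (T^[k]) x|) ^ β := by
  rw [Theta, ← nsmul_eq_mul, ← Finset.sum_filter_of_ne
    (p := fun w : Fin k → ι => (branchDom T I w).Nonempty)]
  · exact Finset.sum_le_card_nsmul _ _ _ fun w _ => theta_rpow_le hβ (hw w) hbdd
  · intro w _ hne
    by_contra h
    rw [Set.not_nonempty_iff_eq_empty] at h
    exact hne (by rw [theta_of_empty h, Real.zero_rpow hβ.ne'])

theorem Theta_nonneg (β : ℝ) (k : ℕ) : 0 ≤ Theta T I β k :=
  Finset.sum_nonneg fun w _ => Real.rpow_nonneg (theta_nonneg w) β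

theorem ThetaInf_le_mul {β Λ C : ℝ} {S : ℕ → ℝ} (hC : 0 ≤ C) (hS : ∀ k, 0 ≤ S k)
    (hΛ : Tendsto (fun k : ℕ => S k ^ (1 / (k : ℝ))) atTop (𝓝 Λ))
    (h : ∃ᶠ k in atTop, Theta T I β k ≤ C ^ k * S k) : ThetaInf T I β ≤ C * Λ := by
  have hlim := hΛ.const_mul C
  refine ge_of_tendsto_of_frequently hlim ?_
  refine (h.and_eventually (eventually_gt_atTop 0)).mono fun k hk => ?_
  have hb : BddBelow (range fun k : {n : ℕ // 0 < n} =>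
      Theta T I β (k : ℕ) ^ (1 / ((k : ℕ) : ℝ))) := by
    refine ⟨0, ?_⟩
    rintro _ ⟨n, rfl⟩
    exact Real.rpow_nonneg (Theta_nonneg β _) _
  calc ThetaInf T I β ≤ Theta T I β k ^ (1 / (k : ℝ)) := ciInf_le hb ⟨k, hk.2⟩
    _ ≤ (C ^ k * S k) ^ (1 / (k : ℝ)) := by
        have := Theta_nonneg (T := T) (I := I) β k
        gcongr
        exact hk.1
    _ = C * S k ^ (1 / (k : ℝ)) := by
        rw [Real.mul_rpow (by positivity) (hS k), one_div, Real.pow_rpow_inv_natCast hC hk.2.ne']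

end Theta

section Counting

variable {T : ℝ → ℝ} {ι : Type*} [Fintype ι] {I : ι → Set ℝ}

open Classical in
/-- Short intervals meet at most two branch domains of `T^[m]`. -/
theorem exists_pos_card_meeting_le_two (hdisj : Pairwise (Function.onFun Disjoint I)) (m : ℕ)
    (hopen : ∀ w : Fin m → ι, IsOpen (branchDom T I w))
    (hord : ∀ w : Fin m → ι, (branchDom T I w).OrdConnected) :
    ∃ ε > 0, ∀ A : Set ℝ, (∀ x ∈ A, ∀ y ∈ A, y - x < ε) →
      (Finset.univ.filter fun w : Fin m → ι => (branchDom T I w ∩ A).Nonempty).card ≤ 2 := by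
  have hlen : ∀ w : Fin m → ι, ∃ ε > 0, (branchDom T I w).Nonempty →
      ∃ p ∈ branchDom T I w, p + ε ∈ branchDom T I w := by
    intro w
    by_cases hw : (branchDom T I w).Nonempty
    · obtain ⟨p, hp⟩ := hw
      obtain ⟨r, hr, hball⟩ := Metric.isOpen_iff.1 (hopen w) p hp
      refine ⟨r / 2, by positivity, fun _ => ⟨p, hp, hball ?_⟩⟩
      rw [Metric.mem_ball, Real.dist_eq, add_sub_cancel_left, abs_of_pos (by positivity)]
      linarith
    · exact ⟨1, one_pos, fun h => absurd h hw⟩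
  choose e he hlen using hlen
  obtain ⟨ε, hε, hεe⟩ : ∃ ε > 0, ∀ w, ε ≤ e w := by
    have h : ∀ᶠ ε in 𝓝[>] (0 : ℝ), ∀ w, ε ≤ e w := eventually_all.2 fun w =>
      nhdsWithin_le_nhds (eventually_le_nhds (he w))
    obtain ⟨ε, h1, h2⟩ := (h.and self_mem_nhdsWithin).exists
    exact ⟨ε, h2, h1⟩
  refine ⟨ε, hε, fun A hA => ?_⟩
  have key : ∀ u v w : Fin m → ι, ∀ a b c : ℝ, a ∈ branchDom T I u ∩ A →
      b ∈ branchDom T I v ∩ A → c ∈ branchDom T I w ∩ A → u ≠ v → v ≠ w → a < b → b < c →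
      False := by
    intro u v w a b c ha hb hc huv hvw hab hbc
    obtain ⟨p, hp, hq⟩ := hlen v ⟨b, hb.1⟩
    have h1 : a < p := by
      by_contra h
      exact huv (eq_of_mem_branchDom hdisj ha.1 ((hord v).out hp hb.1 ⟨not_lt.1 h, hab.le⟩))
    have h2 : p + e v < c := by
      by_contra h
      exact hvw (eq_of_mem_branchDom hdisj ((hord v).out hb.1 hq ⟨hbc.le, not_lt.1 h⟩) hc.1)
    have h3 := hA a ha.2 c hc.2
    have h4 := hεe v
    linarith
  by_contra hcard
  obtain ⟨u, v, w, hu, hv, hw, huv, huw, hvw⟩ := Finset.two_lt_card_iff.1 (not_le.1 hcard)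
  simp only [Finset.mem_filter, Finset.mem_univ, true_and] at hu hv hw
  obtain ⟨a, ha⟩ := hu
  obtain ⟨b, hb⟩ := hv
  obtain ⟨c, hc⟩ := hw
  have hab : a ≠ b := by
    rintro rfl; exact huv (eq_of_mem_branchDom hdisj ha.1 hb.1)
  have hac : a ≠ c := by
    rintro rfl; exact huw (eq_of_mem_branchDom hdisj ha.1 hc.1)
  have hbc : b ≠ c := by
    rintro rfl; exact hvw (eq_of_mem_branchDom hdisj hb.1 hc.1)
  rcases lt_or_gt_of_ne hab with h1 | h1 <;> rcases lt_or_gt_of_ne hac with h2 | h2 <;>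
    rcases lt_or_gt_of_ne hbc with h3 | h3
  · exact key u v w a b c ha hb hc huv hvw h1 h3
  · exact key u w v a c b ha hc hb huw hvw.symm h2 h3
  · linarith
  · exact key w u v c a b hc ha hb huw.symm huv h2 h1
  · exact key v u w b a c hb ha hc huv.symm huw h1 h2
  · linarith
  · exact key v w u b c a hb hc ha hvw huw.symm h3 h2
  · exact key w v u c b a hc hb ha hvw.symm huv.symm h3 h1

open Classical in
/-- If each `T^[j * m]`-image of `A`, `j < k`, meets at most two branch domains of `T^[m]`, then
`A` meets at most `2 ^ k` branch domains of `T^[k * m]`. -/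
theorem card_meeting_mul_le_two_pow {m k : ℕ} {A : Set ℝ}
    (h : ∀ j < k, (Finset.univ.filter fun w : Fin m → ι =>
      (branchDom T I w ∩ T^[m * j] '' A).Nonempty).card ≤ 2) :
    (Finset.univ.filter fun w : Fin (k * m) → ι => (branchDom T I w ∩ A).Nonempty).card
      ≤ 2 ^ k := by
  let P : Fin k → Finset (Fin m → ι) := fun j =>
    Finset.univ.filter fun w : Fin m → ι => (branchDom T I w ∩ T^[m * (j : ℕ)] '' A).Nonempty
  calc _ ≤ (Fintype.piFinset P).card := by
        refine Finset.card_le_card_of_injOn (fun w j i => w (finProdFinEquiv (j, i))) ?_ ?_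
        · intro w hw
          simp only [Finset.coe_filter, Finset.mem_univ, true_and, mem_ofPred_eq] at hw
          obtain ⟨x, hx, hxA⟩ := hw
          simp only [Finset.mem_coe, Fintype.mem_piFinset, P, Finset.mem_filter,
            Finset.mem_univ, true_and]
          intro j
          refine ⟨T^[m * (j : ℕ)] x, fun i => ?_, x, hxA, rfl⟩
          rw [← Function.iterate_add_apply]
          exact hx (finProdFinEquiv (j, i))
        · intro v _ w _ hvw
          funext n
          have := congrFun (congrFun hvw (finProdFinEquiv.symm n).1) (finProdFinEquiv.symm n).2
          beta_reduce at this
          rwa [Prod.mk.eta, Equiv.apply_symm_apply] at this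
    _ = ∏ j, (P j).card := Fintype.card_piFinset P
    _ ≤ ∏ _j : Fin k, 2 := Finset.prod_le_prod' fun j _ => h j j.2
    _ = 2 ^ k := by simp

open Classical in
/-- The number of branches of `T^[k * m]` is at most `2 ^ k` times the size of a dynamical cover at
a small scale depending only on `m`. -/
theorem exists_entourage_card_branches_le {F : Set ℝ}
    (hdisj : Pairwise (Function.onFun Disjoint I)) {m : ℕ} (hm : 0 < m)
    (hF : ∀ k, ∀ w : Fin (k * m) → ι, 0 < k → branchDom T I w ⊆ F)
    (hopen : ∀ w : Fin m → ι, IsOpen (branchDom T I w))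
    (hord : ∀ w : Fin m → ι, (branchDom T I w).OrdConnected) :
    ∃ U ∈ uniformity ℝ, ∀ k, 0 < k → ∀ s : Finset ℝ, Dynamics.IsDynCoverOf T F U (k * m) s →
      (Finset.univ.filter fun w : Fin (k * m) → ι => (branchDom T I w).Nonempty).card
        ≤ s.card * 2 ^ k := by
  obtain ⟨ε, hε, hA⟩ := exists_pos_card_meeting_le_two (T := T) hdisj m hopen hord
  refine ⟨{p | dist p.1 p.2 < ε / 2}, Metric.dist_mem_uniformity (by positivity), ?_⟩
  intro k hk s hs
  let B : ℝ → Set ℝ := fun c => {x | ∀ j < k * m, dist (T^[j] x) (T^[j] c) < ε / 2}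
  let W : ℝ → Finset (Fin (k * m) → ι) := fun c =>
    Finset.univ.filter fun w : Fin (k * m) → ι => (branchDom T I w ∩ B c).Nonempty
  have hW : ∀ c, (W c).card ≤ 2 ^ k := by
    intro c
    refine card_meeting_mul_le_two_pow fun j hj => hA _ ?_
    have hjm : m * j < k * m := by rw [mul_comm k]; gcongr
    rintro _ ⟨x, hx, rfl⟩ _ ⟨y, hy, rfl⟩
    have h1 := hx _ hjm
    have h2 := hy _ hjm
    rw [Real.dist_eq, abs_lt] at h1 h2
    linarith [h1.1, h2.2]
  refine (Finset.card_le_card ?_).trans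
    (Finset.card_biUnion_le_card_mul s W (2 ^ k) fun c _ => hW c)
  intro w hw
  simp only [Finset.mem_filter, Finset.mem_univ, true_and] at hw
  obtain ⟨x, hx⟩ := hw
  obtain ⟨c, hc, hxc⟩ := hs (hF k w hk hx)
  rw [Dynamics.mem_dynEntourage] at hxc
  simp only [Finset.mem_biUnion, W, Finset.mem_filter, Finset.mem_univ, true_and]
  exact ⟨c, hc, x, hx, hxc⟩

end Counting

open Classical in
/-- The exponential growth rate of the number of branches is at most the topological entropy. -/
theorem frequently_card_branches_le_exp {T : ℝ → ℝ} {ι : Type*} [Fintype ι] {I : ι → Set ℝ}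
    {F : Set ℝ} (hdisj : Pairwise (Function.onFun Disjoint I))
    (hF : ∀ n, 0 < n → ∀ w : Fin n → ι, branchDom T I w ⊆ F)
    (hopen : ∀ n, ∀ w : Fin n → ι, IsOpen (branchDom T I w))
    (hord : ∀ n, ∀ w : Fin n → ι, (branchDom T I w).OrdConnected)
    {h a : ℝ} (hent : Dynamics.coverEntropy T F = (h : EReal)) (ha : h < a) :
    ∃ᶠ n : ℕ in atTop,
      ((Finset.univ.filter fun w : Fin n → ι => (branchDom T I w).Nonempty).card : ℝ)
        ≤ Real.exp a ^ n := by
  obtain ⟨b, hb, hba⟩ := exists_between ha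
  obtain ⟨m, hm⟩ := exists_nat_gt (Real.log 2 / (a - b))
  have hm0 : 0 < m := by
    have : (0 : ℝ) < m := lt_of_le_of_lt
      (div_nonneg (Real.log_nonneg one_le_two) (sub_pos.2 hba).le) hm
    exact_mod_cast this
  have hlog : Real.log 2 < m * (a - b) := (div_lt_iff₀ (sub_pos.2 hba)).1 hm
  obtain ⟨U, hU, hcount⟩ := exists_entourage_card_branches_le (T := T) (F := F) hdisj hm0
    (fun k w hk => hF _ (Nat.mul_pos hk hm0) w) (hopen m) (hord m)
  have hlt : ExpGrowth.expGrowthSup (fun n : ℕ => (Dynamics.coverMincard T F U n : ENNReal))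
      < (b : EReal) :=
    lt_of_le_of_lt (Dynamics.coverEntropyEntourage_le_coverEntropy T F hU)
      (hent ▸ EReal.coe_lt_coe_iff.2 hb)
  have hev := ExpGrowth.eventually_le_exp hlt
  have htend : Tendsto (fun k : ℕ => k * m) atTop atTop := tendsto_id.atTop_mul_const' hm0
  refine htend.frequently (Eventually.frequently ?_)
  filter_upwards [htend.eventually hev, eventually_gt_atTop 0] with k hk hk0
  have hcast : (b : EReal) * ((k * m : ℕ) : EReal) = ((b * (k * m : ℕ) : ℝ) : EReal) := by
    push_cast; rfl
  rw [hcast, EReal.exp_coe] at hk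
  have hfin : Dynamics.coverMincard T F U (k * m) < ⊤ := by
    rw [← ENat.toENNReal_lt_top]
    exact hk.trans_lt ENNReal.ofReal_lt_top
  obtain ⟨s, hs, hcard⟩ := (Dynamics.coverMincard_finite_iff T F U (k * m)).1 hfin
  have hs' : (s.card : ℝ) ≤ Real.exp (b * (k * m : ℕ)) := by
    rw [← hcard, ENat.toENNReal_coe] at hk
    rwa [← ENNReal.ofReal_natCast, ENNReal.ofReal_le_ofReal_iff (Real.exp_pos _).le] at hk
  calc _ ≤ (s.card : ℝ) * 2 ^ k := by exact_mod_cast hcount k hk0 s hs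
    _ ≤ Real.exp (b * (k * m : ℕ)) * Real.exp (m * (a - b)) ^ k := by
        gcongr
        rw [← Real.exp_log (zero_lt_two (α := ℝ))]
        exact Real.exp_le_exp.2 hlog.le
    _ = Real.exp a ^ (k * m) := by
        rw [← Real.exp_nat_mul, ← Real.exp_nat_mul, ← Real.exp_add]
        push_cast
        ring_nf

/-- If `Λ = lim_k (sup_x |DT^k(x)|^{-β})^{1/k}`, then
`Θ^∞(β) ≤ (#P¹) Λ` always, and when `T` is continuous moreover
`Θ^∞(β) ≤ e^{h_top(T)} Λ`, where `h_top` is the topological entropy of `T` on `[0,1]`. -/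
theorem theta_entropy_bound
    {ι : Type*} [Fintype ι] [Nonempty ι] (T : ℝ → ℝ) (I : ι → Set ℝ) (β : ℝ) (hβ : 0 < β)
    (hopen : ∀ i, IsOpen (I i)) (hord : ∀ i, (I i).OrdConnected)
    (hne : ∀ i, (I i).Nonempty) (hsub : ∀ i, I i ⊆ Ioo (0 : ℝ) 1)
    (hdisj : Pairwise (Function.onFun Disjoint I))
    (hcov : Ioo (0 : ℝ) 1 ⊆ closure (⋃ i, I i))
    (hC1 : ∀ i, ContDiffOn ℝ 1 T (I i))
    (hexp : ∀ i, ∀ x ∈ I i, 1 < |deriv T x|)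
    (hmaps : MapsTo T (Icc (0 : ℝ) 1) (Icc (0 : ℝ) 1))
    (Λ : ℝ)
    (hΛ : Tendsto
      (fun k : ℕ => (⨆ x ∈ Icc (0 : ℝ) 1, (1 / |deriv (T^[k]) x|) ^ β) ^ (1 / (k : ℝ)))
      atTop (𝓝 Λ))
    (htop : ℝ) (hent : Dynamics.coverEntropy T (Icc (0 : ℝ) 1) = (htop : EReal)) :
    (ContinuousOn T (Icc (0 : ℝ) 1) → ThetaInf T I β ≤ Real.exp htop * Λ) ∧
    ThetaInf T I β ≤ (Fintype.card ι : ℝ) * Λ := by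
  classical
  have hcont : ∀ i, ContinuousOn T (I i) := fun i => (hC1 i).continuousOn
  have hdiff : ∀ i, ∀ x ∈ I i, DifferentiableAt ℝ T x := fun i x hx =>
    ((hC1 i).differentiableOn one_ne_zero).differentiableAt ((hopen i).mem_nhds hx)
  have hinj : ∀ i, InjOn T (I i) := fun i => injOn_of_deriv_ne_zero (hord i) (hcont i)
    fun x hx h0 => by have := hexp i x hx; simp [h0] at this; linarith
  have hdom : ∀ n, 0 < n → ∀ w : Fin n → ι, branchDom T I w ⊆ Icc 0 1 := fun n hn w x hx =>
    Ioo_subset_Icc_self (hsub _ (hx ⟨0, hn⟩))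
  have hle : ∀ k, 0 < k → Theta T I β k ≤
      (Finset.univ.filter fun w : Fin k → ι => (branchDom T I w).Nonempty).card *
        ⨆ x ∈ Icc (0 : ℝ) 1, (1 / |deriv (T^[k]) x|) ^ β := fun k hk =>
    Theta_le_card_mul hβ (hdom k hk) (bddAbove_rpow_inv_abs_deriv hβ.le hdiff hexp
      (finite_Icc_diff_iUnion_branchDom hmaps hinj (finite_Icc_diff_iUnion hord hsub hcov) k))
  constructor
  · intro _
    have hbound : ∀ a > htop, ThetaInf T I β ≤ Real.exp a * Λ := fun a ha => by
      refine ThetaInf_le_mul (Real.exp_pos a).le (biSup_rpow_nonneg T β) hΛ ?_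
      refine ((frequently_card_branches_le_exp hdisj hdom
        (fun n w => isOpen_branchDom hopen hcont w)
        (fun n w => ordConnected_branchDom hord hcont hinj w) hent ha).and_eventually
          (eventually_gt_atTop 0)).mono fun k hk => (hle k hk.2).trans ?_
      exact mul_le_mul_of_nonneg_right hk.1 (biSup_rpow_nonneg T β k)
    have hlim : Tendsto (fun a => Real.exp a * Λ) (𝓝[>] htop) (𝓝 (Real.exp htop * Λ)) :=
      ((Real.continuous_exp.mul continuous_const).tendsto htop).mono_left nhdsWithin_le_nhds
    exact ge_of_tendsto hlim (eventually_mem_nhdsWithin.mono hbound)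
  · refine ThetaInf_le_mul (Nat.cast_nonneg _) (biSup_rpow_nonneg T β) hΛ ?_
    refine ((eventually_gt_atTop 0).mono fun k hk => (hle k hk).trans ?_).frequently
    refine mul_le_mul_of_nonneg_right ?_ (biSup_rpow_nonneg T β k)
    have hcard := Finset.card_le_univ
      (Finset.univ.filter fun w : Fin k → ι => (branchDom T I w).Nonempty)
    rw [Fintype.card_fun, Fintype.card_fin] at hcard
    exact_mod_cast hcard
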